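/- arXiv:1708.00952 — 2 statements merged into one kernel-verified Lean document; each statement's English description precedes it below -/
import Mathlib

section
/- Let σ > 0 and consider an adaptive one-bit scheme of length n with noise level σ, with conditional pmf q(m|θ) for m ∈ {−1,1}ⁿ. For every θ ∈ ℝ such that q(m|θ) > 0 for all m ∈ {−1,1}ⁿ, the Fisher information of the message string with respect to θ satisfies Σ_{m∈{−1,1}ⁿ} (∂q(m|θ)/∂θ)² / q(m|θ) ≤ 2n/(πσ²). -/
open Real MeasureTheory ProbabilityTheory

/-- The conditional pmf `q(m|θ)` of the message string of an adaptive one-bit scheme: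
the scheme is given by measurable sets `A i m ⊆ ℝ` indexed by `i < n` and the string
`m ∈ {−1,1}ⁱ` of previously sent bits (encoded as `Bool`s, `true ↔ 1`), and
`q(m|θ) = ∏_i ν_θ(B_i(m))` where `ν_θ = N(θ,σ²)` and `B_i(m)` is `A i (m₁,…,m_{i−1})`
if `m_i = 1` and its complement otherwise. -/
noncomputable def schemeQ (n : ℕ) (σ : ℝ) (A : (i : Fin n) → (Fin i → Bool) → Set ℝ)
    (m : Fin n → Bool) (θ : ℝ) : ℝ :=
  ∏ i : Fin n,
    (gaussianReal θ ((σ ^ 2).toNNReal)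
      (if m i then A i (fun j => m (Fin.castLE i.isLt.le j))
       else (A i (fun j => m (Fin.castLE i.isLt.le j)))ᶜ)).toReal

/-- A square root of the Gaussian mass of a square is bounded by that of the circumscribed disc. -/
lemma sq_integral_exp_neg_sq_div_two_le (t : ℝ) :
    (∫ x in (0 : ℝ)..t, exp (-(x ^ 2 / 2))) ^ 2 ≤ Real.pi / 2 * (1 - exp (-t ^ 2)) := by
  set E : ℝ → ℝ := fun t => ∫ x in (0 : ℝ)..t, exp (-(x ^ 2 / 2)) with hE
  set G : ℝ → ℝ := fun t =>
    ∫ y in (0 : ℝ)..1, 2 * exp (-(t ^ 2 * (1 + y ^ 2) / 2)) / (1 + y ^ 2) with hG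
  have hpos (y : ℝ) : 0 < 1 + y ^ 2 := by positivity
  have hEd (t : ℝ) : HasDerivAt E (exp (-(t ^ 2 / 2))) t := by
    have hc : Continuous fun x : ℝ => exp (-(x ^ 2 / 2)) := by fun_prop
    exact hc.integral_hasStrictDerivAt 0 t |>.hasDerivAt
  have hGd (t : ℝ) : HasDerivAt G (-(2 * exp (-(t ^ 2 / 2)) * E t)) t := by
    have hGd' : HasDerivAt G
        (∫ y in (0 : ℝ)..1, -(2 * t * exp (-(t ^ 2 * (1 + y ^ 2) / 2)))) t := by
      refine (intervalIntegral.hasDerivAt_integral_of_dominated_loc_of_deriv_le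
        (F := fun t y => 2 * exp (-(t ^ 2 * (1 + y ^ 2) / 2)) / (1 + y ^ 2))
        (F' := fun t y => -(2 * t * exp (-(t ^ 2 * (1 + y ^ 2) / 2))))
        (bound := fun _ => 2 * (|t| + 1)) (Metric.ball_mem_nhds t one_pos)
        (.of_forall fun x => ?_) ?_ ?_ (.of_forall fun y _ x hx => ?_) ?_
        (.of_forall fun y _ x _ => ?_)).2
      · exact Continuous.aestronglyMeasurable
          (by fun_prop (disch := intro y; exact (hpos y).ne'))
      · exact Continuous.intervalIntegrable
          (by fun_prop (disch := intro y; exact (hpos y).ne')) _ _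
      · exact Continuous.aestronglyMeasurable (by fun_prop)
      · rw [norm_neg, norm_mul, norm_mul, Real.norm_eq_abs, Real.norm_eq_abs, Real.norm_eq_abs,
          abs_of_pos (exp_pos _), abs_two]
        have h1 : |x| ≤ |t| + 1 := by
          have h := abs_sub_abs_le_abs_sub x t
          rw [Metric.mem_ball, Real.dist_eq] at hx
          linarith
        have h2 : exp (-(x ^ 2 * (1 + y ^ 2) / 2)) ≤ 1 :=
          exp_le_one_iff.2 (neg_nonpos.2 (by positivity))
        calc 2 * |x| * exp (-(x ^ 2 * (1 + y ^ 2) / 2)) ≤ 2 * |x| * 1 := by gcongr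
          _ ≤ 2 * (|t| + 1) := by linarith
      · exact intervalIntegrable_const
      · have h := ((((hasDerivAt_pow 2 x).mul_const (1 + y ^ 2)).div_const 2).fun_neg.exp.const_mul
          2).div_const (1 + y ^ 2)
        refine h.congr_deriv ?_
        have := (hpos y).ne'
        field_simp
        norm_num
    refine hGd'.congr_deriv ?_
    symm
    have h1 : t * ∫ y in (0 : ℝ)..1, exp (-((t * y) ^ 2 / 2)) = E t := by
      have := intervalIntegral.mul_integral_comp_mul_left
        (f := fun x => exp (-(x ^ 2 / 2))) (a := 0) (b := 1) t
      simpa using this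
    rw [← h1, ← mul_assoc, ← neg_mul, ← intervalIntegral.integral_const_mul]
    refine intervalIntegral.integral_congr fun y _ => ?_
    have : exp (-(t ^ 2 * (1 + y ^ 2) / 2)) = exp (-(t ^ 2 / 2)) * exp (-((t * y) ^ 2 / 2)) := by
      rw [← exp_add]; congr 1; ring
    simp only [this]
    ring
  have hconst : E t ^ 2 + G t = E 0 ^ 2 + G 0 := by
    have hd (s : ℝ) : HasDerivAt (fun s => E s ^ 2 + G s) 0 s := by
      refine (((hEd s).fun_pow 2).add (hGd s)).congr_deriv ?_
      push_cast
      ring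
    exact is_const_of_deriv_eq_zero (fun s => (hd s).differentiableAt) (fun s => (hd s).deriv) t 0
  have hinv : ∫ y in (0 : ℝ)..1, 1 / (1 + y ^ 2) = Real.pi / 4 := by
    rw [integral_one_div_one_add_sq, arctan_one, arctan_zero, sub_zero]
  have hG0 : G 0 = Real.pi / 2 := by
    have : G 0 = ∫ y in (0 : ℝ)..1, 2 * (1 / (1 + y ^ 2)) := by
      refine intervalIntegral.integral_congr fun y _ => ?_
      simp [div_eq_mul_inv]
    rw [this, intervalIntegral.integral_const_mul, hinv]
    ring
  have hGt : Real.pi / 2 * exp (-t ^ 2) ≤ G t := by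
    have : Real.pi / 2 * exp (-t ^ 2) = ∫ y in (0 : ℝ)..1, 2 * exp (-t ^ 2) * (1 / (1 + y ^ 2)) := by
      rw [intervalIntegral.integral_const_mul, hinv]
      ring
    rw [this]
    refine intervalIntegral.integral_mono_on zero_le_one
      (Continuous.intervalIntegrable (by fun_prop (disch := intro y; exact (hpos y).ne')) _ _)
      (Continuous.intervalIntegrable (by fun_prop (disch := intro y; exact (hpos y).ne')) _ _)
      fun y hy => ?_
    rw [mul_one_div]
    have hy2 : y ^ 2 ≤ 1 := pow_le_one₀ hy.1 hy.2
    gcongr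
    nlinarith [sq_nonneg t]
  have hE0 : E 0 = 0 := by simp [hE]
  rw [hE0, hG0] at hconst
  change E t ^ 2 ≤ _
  linarith

lemma setIntegral_gaussianReal_eq (μ : ℝ) {v : NNReal} (hv : v ≠ 0) {B : Set ℝ}
    (hB : MeasurableSet B) (f : ℝ → ℝ) :
    ∫ x in B, f x ∂(gaussianReal μ v) = ∫ x in B, gaussianPDFReal μ v x * f x := by
  rw [← integral_indicator hB, ← integral_indicator hB, integral_gaussianReal_eq_integral_smul hv]
  refine integral_congr_ae (.of_forall fun x => ?_)
  by_cases hx : x ∈ B <;> simp [hx]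

lemma integrable_id_gaussianReal (μ : ℝ) (v : NNReal) :
    Integrable (fun x : ℝ => x) (gaussianReal μ v) :=
  (memLp_id_gaussianReal 1).integrable le_rfl

lemma gaussianPDFReal_zero_one (x : ℝ) :
    gaussianPDFReal 0 1 x = (√(2 * Real.pi))⁻¹ * exp (-(x ^ 2 / 2)) := by
  simp [gaussianPDFReal, neg_div]

lemma setIntegral_Ioi_add_gaussianReal (b : ℝ) :
    ∫ x in Set.Ioi (-b), (x + b) ∂(gaussianReal 0 1) =
      (√(2 * Real.pi))⁻¹ * (exp (-(b ^ 2 / 2)) + b * ∫ x in (0 : ℝ)..b, exp (-(x ^ 2 / 2)))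
        + b / 2 := by
  have hc : √(2 * Real.pi) ≠ 0 := by positivity
  have hi1 : Integrable fun x : ℝ => exp (-(x ^ 2 / 2)) := by
    convert integrable_exp_neg_mul_sq (b := 1 / 2) (by norm_num) using 3
    ring
  have hi2 : Integrable fun x : ℝ => x * exp (-(x ^ 2 / 2)) := by
    convert integrable_mul_exp_neg_mul_sq (b := 1 / 2) (by norm_num) using 4
    ring
  have h1 : ∫ x in Set.Ioi (-b), x * exp (-(x ^ 2 / 2)) = exp (-(b ^ 2 / 2)) := by
    have hl : Filter.Tendsto (fun x : ℝ => -exp (-(x ^ 2 / 2))) Filter.atTop (nhds 0) := by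
      rw [← neg_zero]
      refine (tendsto_exp_neg_atTop_nhds_zero.comp ?_).neg
      exact (Filter.tendsto_pow_atTop two_ne_zero).atTop_div_const two_pos
    rw [integral_Ioi_of_hasDerivAt_of_tendsto' (f := fun x => -exp (-(x ^ 2 / 2))) (m := 0)
      (fun x _ => ?_) hi2.integrableOn hl]
    · simp
    · refine ((hasDerivAt_pow 2 x).div_const 2).fun_neg.exp.fun_neg.congr_deriv ?_
      push_cast
      ring
  have h2 : ∫ x in Set.Ioi (-b), exp (-(x ^ 2 / 2)) =
      (∫ x in (0 : ℝ)..b, exp (-(x ^ 2 / 2))) + √(2 * Real.pi) / 2 := by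
    rw [← intervalIntegral.integral_interval_add_Ioi (b := 0) hi1.integrableOn hi1.integrableOn]
    congr 1
    · have := intervalIntegral.integral_comp_neg (a := 0) (b := b)
        (fun x : ℝ => exp (-(x ^ 2 / 2)))
      simp only [neg_sq, neg_zero] at this
      exact this.symm
    · have := integral_gaussian_Ioi (1 / 2)
      rw [show 2 * Real.pi = Real.pi / (1 / 2) by ring, ← this]
      refine integral_congr_ae (.of_forall fun x => ?_)
      simp only
      congr 1
      ring
  rw [setIntegral_gaussianReal_eq _ one_ne_zero measurableSet_Ioi]
  have h3 (x : ℝ) : gaussianPDFReal 0 1 x * (x + b) =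
      (√(2 * Real.pi))⁻¹ * (x * exp (-(x ^ 2 / 2)) + b * exp (-(x ^ 2 / 2))) := by
    rw [gaussianPDFReal_zero_one]; ring
  simp_rw [h3]
  rw [integral_const_mul, integral_add hi2.integrableOn (hi1.const_mul b).integrableOn,
    integral_const_mul, h1, h2]
  field_simp
  ring

lemma setIntegral_add_gaussianReal_le {B : Set ℝ} (hB : MeasurableSet B) (b : ℝ) :
    ∫ x in B, x ∂(gaussianReal 0 1) + b * (gaussianReal 0 1).real B ≤
      (√(2 * Real.pi))⁻¹ * (exp (-(b ^ 2 / 2)) + b * ∫ x in (0 : ℝ)..b, exp (-(x ^ 2 / 2)))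
        + b / 2 := by
  have hi := integrable_id_gaussianReal 0 1
  calc _ = ∫ x in B, (x + b) ∂(gaussianReal 0 1) := by
        rw [integral_add hi.integrableOn (integrable_const b).integrableOn, setIntegral_const,
          smul_eq_mul, mul_comm b]
    _ ≤ ∫ x in {x | 0 ≤ x + b}, (x + b) ∂(gaussianReal 0 1) :=
        setIntegral_le_nonneg hB (by fun_prop : Continuous fun x : ℝ => x + b).stronglyMeasurable
          (hi.add (integrable_const b))
    _ = ∫ x in Set.Ioi (-b), (x + b) ∂(gaussianReal 0 1) := by
        have : {x : ℝ | 0 ≤ x + b} = Set.Ici (-b) := by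
          ext x
          simp only [Set.mem_ofPred_eq, Set.mem_Ici]
          constructor <;> intro h <;> linarith
        rw [this, setIntegral_gaussianReal_eq _ one_ne_zero measurableSet_Ici,
          setIntegral_gaussianReal_eq _ one_ne_zero measurableSet_Ioi, integral_Ici_eq_integral_Ioi]
    _ = _ := setIntegral_Ioi_add_gaussianReal b

/-- Among all sets of a given Gaussian measure, the first moment is controlled by the measure. -/
lemma sq_setIntegral_id_gaussianReal_le {B : Set ℝ} (hB : MeasurableSet B) :
    (∫ x in B, x ∂(gaussianReal 0 1)) ^ 2 ≤
      2 / Real.pi * ((gaussianReal 0 1).real B * (1 - (gaussianReal 0 1).real B)) := by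
  wlog he : 0 ≤ ∫ x in B, x ∂(gaussianReal 0 1) generalizing B
  · have h1 : ∫ x in Bᶜ, x ∂(gaussianReal 0 1) = -∫ x in B, x ∂(gaussianReal 0 1) := by
      have := integral_add_compl hB (integrable_id_gaussianReal 0 1)
      rw [integral_id_gaussianReal] at this
      linarith
    have h2 := this hB.compl (by rw [h1]; linarith)
    rw [h1, probReal_compl_eq_one_sub hB] at h2
    linarith
  set e := ∫ x in B, x ∂(gaussianReal 0 1)
  set p := (gaussianReal 0 1).real B with hp
  have hpi := Real.pi_pos
  rcases he.eq_or_lt with he0 | he0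
  · rw [← he0, zero_pow two_ne_zero]
    have h0 : 0 ≤ p := measureReal_nonneg
    have h1 : 0 ≤ 1 - p := sub_nonneg.2 measureReal_le_one
    positivity
  obtain ⟨b, hb⟩ : ∃ b, b * (Real.pi * e) = 2 * p - 1 :=
    ⟨(2 * p - 1) / (Real.pi * e), by field_simp⟩
  have hmain := setIntegral_add_gaussianReal_le hB b
  have hu := sq_integral_exp_neg_sq_div_two_le b
  set u := ∫ x in (0 : ℝ)..b, exp (-(x ^ 2 / 2))
  set g := exp (-(b ^ 2 / 2)) with hg
  have hg2 : exp (-b ^ 2) = g ^ 2 := by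
    rw [hg, ← exp_nat_mul]; congr 1; push_cast; ring
  rw [hg2] at hu
  set c := (√(2 * Real.pi))⁻¹ with hc
  have hc2 : c ^ 2 * (2 * Real.pi) = 1 := by
    rw [hc, inv_pow, sq_sqrt (by positivity)]
    field_simp
  set L := 2 * e + b * (2 * p - 1) with hL
  have hL1 : L ≤ 2 * c * (g + b * u) := by
    rw [hL]
    change e + b * p ≤ _ at hmain
    linarith
  have hLQ : Real.pi * e * L = 2 * Real.pi * e ^ 2 + (2 * p - 1) ^ 2 := by
    rw [hL, ← hb]; ring
  have hL0 : 0 ≤ L := by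
    rw [hL, ← hb]
    have : b * (b * (Real.pi * e)) = b ^ 2 * (Real.pi * e) := by ring
    rw [this]
    positivity
  have hL2 : L ^ 2 ≤ 4 * c ^ 2 * (g + b * u) ^ 2 := by
    calc L ^ 2 ≤ (2 * c * (g + b * u)) ^ 2 := by gcongr
      _ = _ := by ring
  have hL3 : Real.pi * L ^ 2 ≤ 2 * (g + b * u) ^ 2 := by
    calc Real.pi * L ^ 2 ≤ Real.pi * (4 * c ^ 2 * (g + b * u) ^ 2) := by gcongr
      _ = 2 * (c ^ 2 * (2 * Real.pi)) * (g + b * u) ^ 2 := by ring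
      _ = _ := by rw [hc2]; ring
  have hcs : Real.pi * (g + b * u) ^ 2 ≤ (2 + Real.pi * b ^ 2) * (Real.pi / 2) := by
    have h1 : Real.pi * (g + b * u) ^ 2 ≤ (2 + Real.pi * b ^ 2) * (Real.pi / 2 * g ^ 2 + u ^ 2) := by
      nlinarith [mul_self_nonneg (Real.pi * b * g - 2 * u)]
    refine h1.trans ?_
    gcongr
    linarith
  have hL4 : Real.pi * L ^ 2 ≤ 2 + Real.pi * b ^ 2 := by
    have : Real.pi * (Real.pi * L ^ 2) ≤ Real.pi * (2 + Real.pi * b ^ 2) := by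
      nlinarith
    exact le_of_mul_le_mul_left this hpi
  have hQ : (Real.pi * e * L) ^ 2 ≤ Real.pi * e * L := by
    calc (Real.pi * e * L) ^ 2 = Real.pi * e ^ 2 * (Real.pi * L ^ 2) := by ring
      _ ≤ Real.pi * e ^ 2 * (2 + Real.pi * b ^ 2) := by gcongr
      _ = Real.pi * e * L := by rw [hLQ, ← hb]; ring
  have hQ1 : Real.pi * e * L ≤ 1 := by
    by_contra! h
    nlinarith
  rw [hLQ] at hQ1
  rw [div_mul_eq_mul_div, le_div_iff₀ hpi]
  nlinarith

lemma hasDerivAt_gaussianReal_real (θ₀ : ℝ) {v : NNReal} (hv : v ≠ 0) {B : Set ℝ}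
    (hB : MeasurableSet B) :
    HasDerivAt (fun θ => (gaussianReal θ v).real B)
      ((∫ x in B, (x - θ₀) ∂(gaussianReal θ₀ v)) / v) θ₀ := by
  have hv' : (v : ℝ) ≠ 0 := by exact_mod_cast hv
  set X : ℝ → ℝ := fun x => x - θ₀ with hX
  set μ := (gaussianReal θ₀ v).restrict B
  have heq (θ : ℝ) : (gaussianReal θ v).real B =
      exp (-((θ - θ₀) ^ 2 / (2 * v))) * mgf X μ ((θ - θ₀) / v) := by
    have h1 : (gaussianReal θ v).real B = ∫ x in B, (1 : ℝ) ∂(gaussianReal θ v) := by simp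
    rw [h1, mgf, setIntegral_gaussianReal_eq _ hv hB, setIntegral_gaussianReal_eq _ hv hB,
      ← integral_const_mul]
    refine integral_congr_ae (.of_forall fun x => ?_)
    simp only [gaussianPDFReal, hX]
    rw [mul_one, mul_left_comm, ← exp_add, mul_assoc (√_)⁻¹, ← exp_add]
    congr 2
    field_simp
    ring
  have hint : (0 : ℝ) ∈ interior (integrableExpSet X μ) := by
    have : integrableExpSet X μ = Set.univ := by
      refine Set.eq_univ_of_forall fun t => ?_
      have h : Integrable (fun x => exp (t * x)) (gaussianReal θ₀ v) :=
        integrable_exp_mul_gaussianReal t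
      have h2 : (fun x => exp (t * X x)) = fun x => exp (-(t * θ₀)) * exp (t * x) := by
        funext x
        rw [← exp_add]
        congr 1
        simp only [hX]
        ring
      change Integrable (fun x => exp (t * X x)) μ
      rw [h2]
      exact (h.const_mul _).integrableOn
    simp [this]
  have hm : HasDerivAt (mgf X μ) (∫ x, X x ∂μ) ((θ₀ - θ₀) / v) := by
    have := hasDerivAt_mgf hint
    simpa using this
  have hl : HasDerivAt (fun θ : ℝ => (θ - θ₀) / v) (1 / v) θ₀ :=
    ((hasDerivAt_id θ₀).sub_const θ₀).div_const _
  have hg : HasDerivAt (fun θ : ℝ => exp (-((θ - θ₀) ^ 2 / (2 * v)))) 0 θ₀ := by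
    refine ((((hasDerivAt_id θ₀).sub_const θ₀).fun_pow 2).div_const
      (2 * (v : ℝ))).fun_neg.exp.congr_deriv ?_
    simp
  simp_rw [heq]
  refine (hg.mul (hm.comp θ₀ hl)).congr_deriv ?_
  simp [div_eq_mul_inv]

lemma gaussianReal_eq_map_std {σ : ℝ} (θ : ℝ) :
    gaussianReal θ (σ ^ 2).toNNReal = (gaussianReal 0 1).map (fun y => σ * y + θ) := by
  have h : (fun y : ℝ => σ * y + θ) = (fun y => y + θ) ∘ fun y => σ * y := rfl
  rw [h, ← Measure.map_map (by fun_prop) (by fun_prop), gaussianReal_map_const_mul,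
    gaussianReal_map_add_const]
  congr 1
  · simp
  · ext; simp [sq_nonneg]

/-- A one-bit measurement of a Gaussian location family has score controlled by the measure. -/
lemma sq_deriv_gaussianReal_real_le {σ : ℝ} (hσ : 0 < σ) (θ : ℝ) {B : Set ℝ}
    (hB : MeasurableSet B) :
    ((∫ x in B, (x - θ) ∂(gaussianReal θ (σ ^ 2).toNNReal)) / ((σ ^ 2).toNNReal : ℝ)) ^ 2 ≤
      2 / (Real.pi * σ ^ 2) * ((gaussianReal θ (σ ^ 2).toNNReal).real B *
        (1 - (gaussianReal θ (σ ^ 2).toNNReal).real B)) := by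
  have hf : Measurable fun y : ℝ => σ * y + θ := by fun_prop
  have h := sq_setIntegral_id_gaussianReal_le (hf hB)
  have h1 : ∫ x in B, (x - θ) ∂(gaussianReal θ (σ ^ 2).toNNReal) =
      σ * ∫ y in (fun y => σ * y + θ) ⁻¹' B, y ∂(gaussianReal 0 1) := by
    rw [gaussianReal_eq_map_std, setIntegral_map hB
      (by fun_prop : Continuous fun x : ℝ => x - θ).aestronglyMeasurable hf.aemeasurable,
      ← integral_const_mul]
    simp
  have h2 : (gaussianReal θ (σ ^ 2).toNNReal).real B =
      (gaussianReal 0 1).real ((fun y => σ * y + θ) ⁻¹' B) := by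
    rw [gaussianReal_eq_map_std, map_measureReal_apply hf hB]
  rw [h1, h2, Real.coe_toNNReal _ (sq_nonneg σ)]
  calc _ = (∫ y in (fun y => σ * y + θ) ⁻¹' B, y ∂(gaussianReal 0 1)) ^ 2 / σ ^ 2 := by
        field_simp
    _ ≤ _ := div_le_div_of_nonneg_right h (sq_nonneg σ)
    _ = _ := by field_simp

/-- Chain rule for the Fisher information when a string `m` is extended by one bit `b`: here
`q` and `p b` are the (conditional) probabilities and `q'`, `p' b` their derivatives. -/
lemma fisher_info_bit_step {q q' C : ℝ} {p p' : Bool → ℝ} (hq : 0 < q) (hp : ∀ b, 0 < p b)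
    (hsum : p true + p false = 1) (hsum' : p' true + p' false = 0)
    (hC : p' true ^ 2 ≤ C * (p true * (1 - p true))) :
    ∑ b, (q' * p b + q * p' b) ^ 2 / (q * p b) ≤ q' ^ 2 / q + C * q := by
  have ht := hp true
  have hf := hp false
  have hf1 : p false = 1 - p true := by linarith
  have hf2 : p' false = -p' true := by linarith
  rw [Fintype.sum_bool, hf2]
  rw [← hf1] at hC
  have h : (q' * p true + q * p' true) ^ 2 / (q * p true) +
      (q' * p false + q * -p' true) ^ 2 / (q * p false) =
      q' ^ 2 / q * (p true + p false) +
        q * (p' true ^ 2 * (p true + p false) / (p true * p false)) := by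
    field_simp
    ring
  rw [h, hsum, mul_one, mul_one, mul_comm C]
  gcongr
  rwa [div_le_iff₀ (by positivity)]

/-- The probability that the next bit is `b`. -/
noncomputable def bitProb (σ : ℝ) (S : Set ℝ) (b : Bool) (θ : ℝ) : ℝ :=
  (gaussianReal θ (σ ^ 2).toNNReal).real (if b then S else Sᶜ)

lemma bitProb_add (σ : ℝ) {S : Set ℝ} (hS : MeasurableSet S) (θ : ℝ) :
    bitProb σ S true θ + bitProb σ S false θ = 1 := by
  simp [bitProb, probReal_compl_eq_one_sub hS]

lemma differentiableAt_bitProb {σ : ℝ} (hσ : 0 < σ) {S : Set ℝ} (hS : MeasurableSet S) (b : Bool)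
    (θ : ℝ) : DifferentiableAt ℝ (bitProb σ S b) θ := by
  refine (hasDerivAt_gaussianReal_real θ ?_ ?_).differentiableAt
  · simpa using hσ.ne'
  · cases b
    · simpa using hS.compl
    · simpa using hS

lemma deriv_bitProb_add {σ : ℝ} (hσ : 0 < σ) {S : Set ℝ} (hS : MeasurableSet S) (θ : ℝ) :
    deriv (bitProb σ S true) θ + deriv (bitProb σ S false) θ = 0 := by
  rw [← deriv_fun_add (differentiableAt_bitProb hσ hS _ θ) (differentiableAt_bitProb hσ hS _ θ)]
  simp [bitProb_add σ hS]

lemma sq_deriv_bitProb_le {σ : ℝ} (hσ : 0 < σ) {S : Set ℝ} (hS : MeasurableSet S) (θ : ℝ) :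
    deriv (bitProb σ S true) θ ^ 2 ≤
      2 / (Real.pi * σ ^ 2) * (bitProb σ S true θ * (1 - bitProb σ S true θ)) := by
  have hv : (σ ^ 2).toNNReal ≠ 0 := by simpa using hσ.ne'
  have h : HasDerivAt (bitProb σ S true) _ θ := hasDerivAt_gaussianReal_real θ hv hS
  rw [h.deriv]
  exact sq_deriv_gaussianReal_real_le hσ θ hS

lemma schemeQ_snoc (n : ℕ) (σ : ℝ) (A : (i : Fin (n + 1)) → (Fin i → Bool) → Set ℝ)
    (m : Fin n → Bool) (b : Bool) :
    schemeQ (n + 1) σ A (Fin.snoc m b) = fun θ =>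
      schemeQ n σ (fun i => A i.castSucc) m θ * bitProb σ (A (Fin.last n) m) b θ := by
  have hcast (i : Fin n) (j : Fin i) :
      (Fin.snoc m b : Fin (n + 1) → Bool) (Fin.castLE i.castSucc.isLt.le j) =
        m (Fin.castLE i.isLt.le j) :=
    Fin.snoc_castSucc (α := fun _ => Bool) b m (Fin.castLE i.isLt.le j)
  have hlast (j : Fin n) :
      (Fin.snoc m b : Fin (n + 1) → Bool) (Fin.castLE (Fin.last n).isLt.le j) = m j :=
    Fin.snoc_castSucc (α := fun _ => Bool) b m j
  funext θ
  rw [schemeQ, Fin.prod_univ_castSucc]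
  congr 1
  · refine Finset.prod_congr rfl fun i _ => ?_
    rw [Fin.snoc_castSucc]
    simp only [hcast]
    rfl
  · rw [Fin.snoc_last]
    simp only [hlast]
    rfl

lemma sum_snoc {M : Type*} [AddCommMonoid M] (n : ℕ) (f : (Fin (n + 1) → Bool) → M) :
    ∑ m, f m = ∑ m : Fin n → Bool, ∑ b, f (Fin.snoc m b) := by
  rw [← (Fin.snocEquiv fun _ => Bool).sum_comp, Fintype.sum_prod_type_right]
  rfl

lemma sum_schemeQ (n : ℕ) (σ : ℝ) (A : (i : Fin n) → (Fin i → Bool) → Set ℝ)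
    (hA : ∀ i m, MeasurableSet (A i m)) (θ : ℝ) : ∑ m, schemeQ n σ A m θ = 1 := by
  induction n with
  | zero => simp [schemeQ]
  | succ n ih =>
    rw [sum_snoc]
    simp_rw [schemeQ_snoc, Fintype.sum_bool, ← mul_add, bitProb_add σ (hA _ _), mul_one]
    exact ih _ fun i => hA i.castSucc

lemma differentiableAt_schemeQ (n : ℕ) {σ : ℝ} (hσ : 0 < σ)
    (A : (i : Fin n) → (Fin i → Bool) → Set ℝ) (hA : ∀ i m, MeasurableSet (A i m))
    (m : Fin n → Bool) (θ : ℝ) : DifferentiableAt ℝ (schemeQ n σ A m) θ :=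
  DifferentiableAt.fun_finsetProd fun _ _ =>
    differentiableAt_bitProb hσ (hA _ _) _ θ

/-- The Fisher information of the message string of any adaptive one-bit scheme of
length `n` with noise level `σ` is at most `2n/(πσ²)`. -/
theorem adaptive_scheme_fisher_info_le (n : ℕ) (σ : ℝ) (hσ : 0 < σ)
    (A : (i : Fin n) → (Fin i → Bool) → Set ℝ)
    (hA : ∀ i m, MeasurableSet (A i m))
    (θ : ℝ) (hq_pos : ∀ m : Fin n → Bool, 0 < schemeQ n σ A m θ) :
    ∑ m : Fin n → Bool, (deriv (schemeQ n σ A m) θ) ^ 2 / schemeQ n σ A m θ ≤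
      2 * n / (Real.pi * σ ^ 2) := by
  induction n with
  | zero =>
    have (m : Fin 0 → Bool) : schemeQ 0 σ A m = fun _ => 1 := by
      funext θ
      simp [schemeQ]
    simp [this]
  | succ n ih =>
    set A' : (i : Fin n) → (Fin i → Bool) → Set ℝ := fun i => A i.castSucc
    have hA' : ∀ i m, MeasurableSet (A' i m) := fun i => hA i.castSucc
    have hpos (m : Fin n → Bool) (b : Bool) :
        0 < schemeQ n σ A' m θ * bitProb σ (A (Fin.last n) m) b θ := by
      have := hq_pos (Fin.snoc m b)
      rwa [schemeQ_snoc] at this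
    have hq (m : Fin n → Bool) : 0 < schemeQ n σ A' m θ :=
      pos_of_mul_pos_left (hpos m true) ENNReal.toReal_nonneg
    have hp (m : Fin n → Bool) (b : Bool) : 0 < bitProb σ (A (Fin.last n) m) b θ :=
      pos_of_mul_pos_right (hpos m b) (hq m).le
    rw [sum_snoc]
    calc _ = ∑ m : Fin n → Bool, ∑ b,
          (deriv (schemeQ n σ A' m) θ * bitProb σ (A (Fin.last n) m) b θ +
            schemeQ n σ A' m θ * deriv (bitProb σ (A (Fin.last n) m) b) θ) ^ 2 /
              (schemeQ n σ A' m θ * bitProb σ (A (Fin.last n) m) b θ) := by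
          refine Finset.sum_congr rfl fun m _ => Finset.sum_congr rfl fun b _ => ?_
          rw [schemeQ_snoc, deriv_fun_mul (differentiableAt_schemeQ n hσ _ hA' m θ)
            (differentiableAt_bitProb hσ (hA _ _) b θ)]
      _ ≤ ∑ m : Fin n → Bool, (deriv (schemeQ n σ A' m) θ ^ 2 / schemeQ n σ A' m θ +
            2 / (Real.pi * σ ^ 2) * schemeQ n σ A' m θ) :=
          Finset.sum_le_sum fun m _ => fisher_info_bit_step (hq m) (hp m)
            (bitProb_add σ (hA _ _) θ) (deriv_bitProb_add hσ (hA _ _) θ)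
            (sq_deriv_bitProb_le hσ (hA _ _) θ)
      _ ≤ 2 * n / (Real.pi * σ ^ 2) + 2 / (Real.pi * σ ^ 2) := by
          rw [Finset.sum_add_distrib, ← Finset.mul_sum, sum_schemeQ n σ A' hA' θ, mul_one]
          gcongr
          exact ih A' hA' hq
      _ = _ := by push_cast; ring
end

section
/- Let U be a real random variable whose law has a log-concave probability density f that is continuous, strictly positive, and has finite second moment. Let τ be the unique real solution of 2τ = (∫_τ^∞ u f(u) du)/(∫_τ^∞ f(u) du) + (∫_{−∞}^τ u f(u) du)/(∫_{−∞}^τ f(u) du), and let M* (u) = sgn(u − τ). Then for every measurable one-bit function M : ℝ → {−1,1}, one has E[(U − E[U | M(U)])²] ≥ E[(U − E[U | M*(U)])²]; that is, M* minimizes the mean squared error E[(U − E[U|M(U)])²] over all one-bit messages M. -/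
open Real MeasureTheory ProbabilityTheory Filter

/-- `sgn x = 1` if `x > 0` and `−1` otherwise. -/
noncomputable def sgn (x : ℝ) : ℝ := if 0 < x then 1 else -1

/-- Mean of the density `f` conditioned on `(t, ∞)`. -/
noncomputable def upperMean (f : ℝ → ℝ) (t : ℝ) : ℝ :=
  (∫ u in Set.Ioi t, u * f u) / ∫ u in Set.Ioi t, f u

/-- Mean of the density `f` conditioned on `(-∞, t]`. -/
noncomputable def lowerMean (f : ℝ → ℝ) (t : ℝ) : ℝ :=
  (∫ u in Set.Iic t, u * f u) / ∫ u in Set.Iic t, f u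

/-- Squared error of the quantizer with threshold `t` whose values are the conditional means. -/
noncomputable def thresholdCost (f : ℝ → ℝ) (t : ℝ) : ℝ :=
  (∫ u, u ^ 2 * f u) - (∫ u in Set.Iic t, u * f u) ^ 2 / (∫ u in Set.Iic t, f u)
    - (∫ u in Set.Ioi t, u * f u) ^ 2 / ∫ u in Set.Ioi t, f u

/-- A log-concave function satisfies the Pólya frequency inequality of order two. -/
theorem mul_le_mul_of_concaveOn_log {f : ℝ → ℝ} (hpos : ∀ x, 0 < f x)
    (hlog : ConcaveOn ℝ Set.univ (fun x => Real.log (f x)))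
    {x y d : ℝ} (hxy : x ≤ y) (hd : 0 ≤ d) : f x * f (y + d) ≤ f (x + d) * f y := by
  rcases hd.eq_or_lt with rfl | hd
  · simp
  have hL : 0 < y - x + d := by linarith
  have hp : 0 ≤ d / (y - x + d) := by positivity
  have hq : 0 ≤ (y - x) / (y - x + d) := div_nonneg (by linarith) hL.le
  have hpq : (y - x) / (y - x + d) + d / (y - x + d) = 1 := by field_simp
  have h1 := hlog.2 (Set.mem_univ x) (Set.mem_univ (y + d)) hq hp hpq
  have h2 := hlog.2 (Set.mem_univ x) (Set.mem_univ (y + d)) hp hq (by rw [add_comm]; exact hpq)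
  have e1 : (y - x) / (y - x + d) * x + d / (y - x + d) * (y + d) = x + d := by
    field_simp; ring
  have e2 : d / (y - x + d) * x + (y - x) / (y - x + d) * (y + d) = y := by
    field_simp; ring
  simp only [smul_eq_mul, e1, e2] at h1 h2
  rw [← Real.log_le_log_iff (mul_pos (hpos _) (hpos _)) (mul_pos (hpos _) (hpos _)),
    Real.log_mul (hpos _).ne' (hpos _).ne', Real.log_mul (hpos _).ne' (hpos _).ne']
  linear_combination h1 + h2 - (Real.log (f x) + Real.log (f (y + d))) * hpq

theorem integral_Ioi_pos {f : ℝ → ℝ} (hpos : ∀ x, 0 < f x) (hint : Integrable f) (t : ℝ) :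
    0 < ∫ u in Set.Ioi t, f u := by
  rw [setIntegral_pos_iff_support_of_nonneg_ae (ae_of_all _ fun x => (hpos x).le)
    hint.integrableOn]
  have : Function.support f = Set.univ := Set.eq_univ_of_forall fun x => (hpos x).ne'
  simp [this]

theorem integral_Iic_pos {f : ℝ → ℝ} (hpos : ∀ x, 0 < f x) (hint : Integrable f) (t : ℝ) :
    0 < ∫ u in Set.Iic t, f u := by
  rw [setIntegral_pos_iff_support_of_nonneg_ae (ae_of_all _ fun x => (hpos x).le)
    hint.integrableOn]
  have : Function.support f = Set.univ := Set.eq_univ_of_forall fun x => (hpos x).ne'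
  simp [this]

theorem setIntegral_Ioi_comp_add_right (h : ℝ → ℝ) (t d : ℝ) :
    ∫ u in Set.Ioi t, h (u + d) = ∫ u in Set.Ioi (t + d), h u := by
  have := (measurePreserving_add_right (volume : Measure ℝ) d).setIntegral_preimage_emb
    (measurableEmbedding_addRight d) h (Set.Ioi (t + d))
  simpa using this

/-- The mean residual life of a log-concave density is nonincreasing. -/
theorem antitone_upperMean_sub {f : ℝ → ℝ} (hpos : ∀ x, 0 < f x)
    (hpf : ∀ x y d : ℝ, x ≤ y → 0 ≤ d → f x * f (y + d) ≤ f (x + d) * f y)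
    (hint : Integrable f) (hint1 : Integrable (fun u => u * f u)) :
    Antitone (fun t => upperMean f t - t) := by
  intro t s hts
  have ht := integral_Ioi_pos hpos hint t
  have hs := integral_Ioi_pos hpos hint s
  set c := upperMean f t with hc
  set r := f (c + (s - t)) / f c with hr
  have hcen : ∫ u in Set.Ioi t, (u * f u - c * f u) = 0 := by
    rw [integral_sub hint1.integrableOn (hint.const_mul c).integrableOn, integral_const_mul, hc,
      upperMean, div_mul_cancel₀ _ ht.ne', sub_self]
  have hpt : ∀ u, (u + (s - t)) * f (u + (s - t)) - (c + (s - t)) * f (u + (s - t))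
      ≤ r * (u * f u - c * f u) := by
    intro u
    have key : (u - c) * (f (u + (s - t)) * f c - f (c + (s - t)) * f u) ≤ 0 := by
      rcases le_total c u with h | h
      · have := hpf c u (s - t) h (by linarith)
        exact mul_nonpos_of_nonneg_of_nonpos (by linarith) (by linarith)
      · have := hpf u c (s - t) h (by linarith)
        exact mul_nonpos_of_nonpos_of_nonneg (by linarith) (by linarith)
    have hfc := hpos c
    rw [hr, div_mul_eq_mul_div, le_div_iff₀ hfc]
    linarith
  have hshift : Integrable fun u => (u + (s - t)) * f (u + (s - t))
      - (c + (s - t)) * f (u + (s - t)) :=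
    (hint1.comp_add_right (s - t)).sub ((hint.comp_add_right (s - t)).const_mul _)
  have hle := setIntegral_mono (s := Set.Ioi t) hshift.integrableOn
    ((hint1.sub (hint.const_mul c)).const_mul r).integrableOn hpt
  have hR : ∫ u in Set.Ioi t, r * (u * f u - c * f u) = 0 := by
    rw [integral_const_mul, hcen, mul_zero]
  have hL := setIntegral_Ioi_comp_add_right (fun u => u * f u - (c + (s - t)) * f u) t (s - t)
  rw [add_sub_cancel, integral_sub hint1.integrableOn (hint.const_mul _).integrableOn,
    integral_const_mul] at hL
  have hfin : (∫ u in Set.Ioi s, u * f u) ≤ (c + (s - t)) * ∫ u in Set.Ioi s, f u := by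
    have := hle.trans_eq hR
    linarith [hL]
  have := (div_le_iff₀ hs).2 hfin
  change upperMean f s - s ≤ c - t
  rw [upperMean]
  linarith

theorem lowerMean_eq_neg_upperMean (f : ℝ → ℝ) (t : ℝ) :
    lowerMean f t = -upperMean (fun x => f (-x)) (-t) := by
  have h1 := integral_comp_neg_Iic t (fun u => u * f (-u))
  have h2 := integral_comp_neg_Iic t (fun u => f (-u))
  simp only [neg_neg, neg_mul, integral_neg] at h1 h2
  rw [lowerMean, upperMean, ← h1, ← h2, neg_div, neg_neg]

theorem monotone_sub_lowerMean {f : ℝ → ℝ} (hpos : ∀ x, 0 < f x)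
    (hpf : ∀ x y d : ℝ, x ≤ y → 0 ≤ d → f x * f (y + d) ≤ f (x + d) * f y)
    (hint : Integrable f) (hint1 : Integrable (fun u => u * f u)) :
    Monotone (fun t => t - lowerMean f t) := by
  have h := antitone_upperMean_sub (f := fun x => f (-x)) (fun x => hpos _)
    (fun x y d hxy hd => by
      have := hpf (-y - d) (-x - d) d (by linarith) hd
      rw [sub_add_cancel, sub_add_cancel] at this
      rw [neg_add', neg_add']
      linarith) hint.comp_neg (by simpa using hint1.comp_neg.neg)
  intro t s hts
  have := h (neg_le_neg hts)
  simp only [lowerMean_eq_neg_upperMean] at this ⊢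
  linarith

theorem le_upperMean {f : ℝ → ℝ} (hpos : ∀ x, 0 < f x) (hint : Integrable f)
    (hint1 : Integrable (fun u => u * f u)) (t : ℝ) : t ≤ upperMean f t := by
  rw [upperMean, le_div_iff₀ (integral_Ioi_pos hpos hint t), ← integral_const_mul]
  exact setIntegral_mono_on (hint.const_mul t).integrableOn hint1.integrableOn measurableSet_Ioi
    fun u hu => mul_le_mul_of_nonneg_right (le_of_lt hu) (hpos u).le

theorem lowerMean_le {f : ℝ → ℝ} (hpos : ∀ x, 0 < f x) (hint : Integrable f)
    (hint1 : Integrable (fun u => u * f u)) (t : ℝ) : lowerMean f t ≤ t := by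
  rw [lowerMean, div_le_iff₀ (integral_Iic_pos hpos hint t), ← integral_const_mul]
  exact setIntegral_mono_on hint1.integrableOn (hint.const_mul t).integrableOn measurableSet_Iic
    fun u hu => mul_le_mul_of_nonneg_right hu (hpos u).le

theorem hasDerivAt_integral_Iic {g : ℝ → ℝ} (hcont : Continuous g) (hint : Integrable g) (t : ℝ) :
    HasDerivAt (fun t => ∫ u in Set.Iic t, g u) (g t) t := by
  have h := (intervalIntegral.integral_hasDerivAt_right (hcont.intervalIntegrable 0 t)
    hcont.stronglyMeasurable.stronglyMeasurableAtFilter hcont.continuousAt).const_add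
    (∫ u in Set.Iic 0, g u)
  refine h.congr_of_eventuallyEq (Eventually.of_forall fun s => ?_)
  have := intervalIntegral.integral_Iic_sub_Iic (a := 0) (b := s) hint.integrableOn
    hint.integrableOn
  simp only
  linarith

theorem hasDerivAt_integral_Ioi {g : ℝ → ℝ} (hcont : Continuous g) (hint : Integrable g) (t : ℝ) :
    HasDerivAt (fun t => ∫ u in Set.Ioi t, g u) (-g t) t := by
  refine ((hasDerivAt_integral_Iic hcont hint t).const_sub (∫ u, g u)).congr_of_eventuallyEq
    (Eventually.of_forall fun s => ?_)
  have := intervalIntegral.integral_Iic_add_Ioi (b := s) hint.integrableOn hint.integrableOn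
  simp only
  linarith

theorem hasDerivAt_thresholdCost {f : ℝ → ℝ} (hpos : ∀ x, 0 < f x) (hcont : Continuous f)
    (hint : Integrable f) (hint1 : Integrable (fun u => u * f u)) (t : ℝ) :
    HasDerivAt (thresholdCost f)
      (f t * (upperMean f t - lowerMean f t) * ((t - lowerMean f t) - (upperMean f t - t))) t := by
  have hF := integral_Iic_pos hpos hint t
  have hG := integral_Ioi_pos hpos hint t
  have hcont1 : Continuous fun u => u * f u := continuous_id.mul hcont
  have h := ((((hasDerivAt_integral_Iic hcont1 hint1 t).pow 2).div
    (hasDerivAt_integral_Iic hcont hint t) hF.ne').const_sub (∫ u, u ^ 2 * f u)).sub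
    (((hasDerivAt_integral_Ioi hcont1 hint1 t).pow 2).div
      (hasDerivAt_integral_Ioi hcont hint t) hG.ne')
  refine HasDerivAt.congr_deriv (f := thresholdCost f) h ?_
  simp only [upperMean, lowerMean, Pi.pow_apply]
  field_simp
  ring

theorem thresholdCost_le {f : ℝ → ℝ} (hpos : ∀ x, 0 < f x) (hcont : Continuous f)
    (hlog : ConcaveOn ℝ Set.univ (fun x => Real.log (f x)))
    (hint : Integrable f) (hint1 : Integrable (fun u => u * f u)) {τ : ℝ}
    (hτ : 2 * τ = upperMean f τ + lowerMean f τ) (t : ℝ) :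
    thresholdCost f τ ≤ thresholdCost f t := by
  have hpf := fun x y d (hxy : x ≤ y) (hd : 0 ≤ d) => mul_le_mul_of_concaveOn_log hpos hlog hxy hd
  have hup := antitone_upperMean_sub hpos hpf hint hint1
  have hlo := monotone_sub_lowerMean hpos hpf hint hint1
  have hder := hasDerivAt_thresholdCost hpos hcont hint hint1
  have hc : Continuous (thresholdCost f) :=
    continuous_iff_continuousAt.2 fun x => (hder x).continuousAt
  have hd : Differentiable ℝ (thresholdCost f) := fun x => (hder x).differentiableAt
  have hfac : ∀ x, 0 ≤ f x * (upperMean f x - lowerMean f x) := fun x =>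
    mul_nonneg (hpos x).le
      (by linarith [le_upperMean hpos hint hint1 x, lowerMean_le hpos hint hint1 x])
  rcases le_total τ t with h | h
  · refine monotoneOn_of_deriv_nonneg (convex_Ici τ) hc.continuousOn hd.differentiableOn
      (fun x hx => ?_) Set.self_mem_Ici h h
    rw [interior_Ici] at hx
    rw [(hder x).deriv]
    have h1 := hup (le_of_lt hx)
    have h2 := hlo (le_of_lt hx)
    simp only at h1 h2
    exact mul_nonneg (hfac x) (by linarith)
  · refine antitoneOn_of_deriv_nonpos (convex_Iic τ) hc.continuousOn hd.differentiableOn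
      (fun x hx => ?_) h Set.self_mem_Iic h
    rw [interior_Iic] at hx
    rw [(hder x).deriv]
    have h1 := hup (le_of_lt hx)
    have h2 := hlo (le_of_lt hx)
    simp only at h1 h2
    exact mul_nonpos_of_nonneg_of_nonpos (hfac x) (by linarith)

theorem integrable_sub_sq_mul {f : ℝ → ℝ} (hint : Integrable f)
    (hint1 : Integrable (fun u => u * f u)) (hint2 : Integrable (fun u => u ^ 2 * f u)) (a : ℝ) :
    Integrable (fun u => (u - a) ^ 2 * f u) := by
  refine ((hint2.sub (hint1.const_mul (2 * a))).add (hint.const_mul (a ^ 2))).congr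
    (ae_of_all _ fun u => ?_)
  simp only [Pi.add_apply, Pi.sub_apply]
  ring

theorem setIntegral_sub_sq_mul {f : ℝ → ℝ} (hint : Integrable f)
    (hint1 : Integrable (fun u => u * f u)) (hint2 : Integrable (fun u => u ^ 2 * f u))
    (a : ℝ) (s : Set ℝ) :
    ∫ u in s, (u - a) ^ 2 * f u = (∫ u in s, u ^ 2 * f u) - 2 * a * (∫ u in s, u * f u)
      + a ^ 2 * ∫ u in s, f u := by
  have hsub : Integrable fun u => u ^ 2 * f u - 2 * a * (u * f u) :=
    hint2.sub (hint1.const_mul _)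
  rw [← integral_const_mul, ← integral_const_mul,
    ← integral_sub hint2.integrableOn (hint1.const_mul _).integrableOn,
    ← integral_add hsub.integrableOn (hint.const_mul _).integrableOn]
  refine integral_congr_ae (ae_of_all _ fun u => ?_)
  ring

theorem lintegral_threshold {f : ℝ → ℝ} (hpos : ∀ x, 0 < f x) (hint : Integrable f)
    (hint1 : Integrable (fun u => u * f u)) (hint2 : Integrable (fun u => u ^ 2 * f u))
    (t a b : ℝ) :
    ∫⁻ u, ENNReal.ofReal (f u) * ENNReal.ofReal (if u ≤ t then (u - a) ^ 2 else (u - b) ^ 2)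
      = ENNReal.ofReal (thresholdCost f t
        + (∫ u in Set.Iic t, f u) * (a - lowerMean f t) ^ 2
        + (∫ u in Set.Ioi t, f u) * (b - upperMean f t) ^ 2) := by
  have ha := integrable_sub_sq_mul hint hint1 hint2 a
  have hb := integrable_sub_sq_mul hint hint1 hint2 b
  have hF := integral_Iic_pos hpos hint t
  have hG := integral_Ioi_pos hpos hint t
  rw [← lintegral_add_compl _ (measurableSet_Iic (a := t)), Set.compl_Iic]
  have e1 : ∫⁻ u in Set.Iic t,
      ENNReal.ofReal (f u) * ENNReal.ofReal (if u ≤ t then (u - a) ^ 2 else (u - b) ^ 2)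
      = ENNReal.ofReal (∫ u in Set.Iic t, (u - a) ^ 2 * f u) := by
    rw [ofReal_integral_eq_lintegral_ofReal ha.integrableOn
      (ae_of_all _ fun u => mul_nonneg (sq_nonneg _) (hpos u).le)]
    refine setLIntegral_congr_fun measurableSet_Iic fun u hu => ?_
    simp only [Set.mem_Iic.1 hu, if_true]
    rw [← ENNReal.ofReal_mul (hpos u).le, mul_comm]
  have e2 : ∫⁻ u in Set.Ioi t,
      ENNReal.ofReal (f u) * ENNReal.ofReal (if u ≤ t then (u - a) ^ 2 else (u - b) ^ 2)
      = ENNReal.ofReal (∫ u in Set.Ioi t, (u - b) ^ 2 * f u) := by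
    rw [ofReal_integral_eq_lintegral_ofReal hb.integrableOn
      (ae_of_all _ fun u => mul_nonneg (sq_nonneg _) (hpos u).le)]
    refine setLIntegral_congr_fun measurableSet_Ioi fun u hu => ?_
    simp only [not_le.2 (Set.mem_Ioi.1 hu), if_false]
    rw [← ENNReal.ofReal_mul (hpos u).le, mul_comm]
  rw [e1, e2, ← ENNReal.ofReal_add
    (integral_nonneg fun u => mul_nonneg (sq_nonneg _) (hpos u).le)
    (integral_nonneg fun u => mul_nonneg (sq_nonneg _) (hpos u).le),
    setIntegral_sub_sq_mul hint hint1 hint2, setIntegral_sub_sq_mul hint hint1 hint2]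
  congr 1
  rw [thresholdCost, ← intervalIntegral.integral_Iic_add_Ioi (b := t) hint2.integrableOn
    hint2.integrableOn, lowerMean, upperMean]
  field_simp
  ring

theorem lintegral_comp_eq_of_map_eq {Ω : Type*} [MeasurableSpace Ω] {μ : Measure Ω} {f : ℝ → ℝ}
    {U : Ω → ℝ} (hf : Measurable f) (hU : Measurable U)
    (hlaw : Measure.map U μ = volume.withDensity (fun u => ENNReal.ofReal (f u)))
    {g : ℝ → ℝ} (hg : Measurable g) :
    ∫⁻ ω, ENNReal.ofReal (g (U ω)) ∂μ = ∫⁻ u, ENNReal.ofReal (f u) * ENNReal.ofReal (g u) := by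
  rw [← lintegral_map (f := fun u => ENNReal.ofReal (g u)) hg.ennreal_ofReal hU, hlaw,
    lintegral_withDensity_eq_lintegral_mul _ hf.ennreal_ofReal hg.ennreal_ofReal]
  rfl

theorem setIntegral_comp_eq_of_map_eq {Ω : Type*} [MeasurableSpace Ω] {μ : Measure Ω} {f : ℝ → ℝ}
    {U : Ω → ℝ} (hf : Measurable f) (hpos : ∀ x, 0 < f x) (hU : Measurable U)
    (hlaw : Measure.map U μ = volume.withDensity (fun u => ENNReal.ofReal (f u)))
    {g : ℝ → ℝ} (hg : Measurable g) {s : Set ℝ} (hs : MeasurableSet s) :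
    ∫ ω in U ⁻¹' s, g (U ω) ∂μ = ∫ u in s, g u * f u := by
  rw [← setIntegral_map hs hg.aestronglyMeasurable hU.aemeasurable, hlaw,
    setIntegral_withDensity_eq_setIntegral_toReal_smul hf.ennreal_ofReal
      (ae_of_all _ fun _ => ENNReal.ofReal_lt_top) _ hs]
  refine integral_congr_ae (ae_of_all _ fun u => ?_)
  simp [ENNReal.toReal_ofReal (hpos u).le, mul_comm]

theorem integrable_of_map_eq {Ω : Type*} [MeasurableSpace Ω] {μ : Measure Ω} {f : ℝ → ℝ}
    {U : Ω → ℝ} (hf : Measurable f) (hpos : ∀ x, 0 < f x) (hU : Measurable U)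
    (hlaw : Measure.map U μ = volume.withDensity (fun u => ENNReal.ofReal (f u)))
    (hint1 : Integrable (fun u => u * f u)) : Integrable U μ := by
  have : Integrable id (Measure.map U μ) := by
    rw [hlaw, integrable_withDensity_iff hf.ennreal_ofReal
      (ae_of_all _ fun _ => ENNReal.ofReal_lt_top)]
    simpa [ENNReal.toReal_ofReal (hpos _).le] using hint1
  exact (integrable_map_measure measurable_id.aestronglyMeasurable hU.aemeasurable).1 this

theorem measurable_sgn : Measurable sgn :=
  Measurable.ite measurableSet_Ioi measurable_const measurable_const

theorem ofReal_thresholdCost_le_lintegral {Ω : Type*} [MeasurableSpace Ω] {μ : Measure Ω}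
    {f : ℝ → ℝ} {U : Ω → ℝ} (hf : Measurable f) (hpos : ∀ x, 0 < f x) (hint : Integrable f)
    (hint1 : Integrable (fun u => u * f u)) (hint2 : Integrable (fun u => u ^ 2 * f u))
    (hU : Measurable U)
    (hlaw : Measure.map U μ = volume.withDensity (fun u => ENNReal.ofReal (f u)))
    {Y : Ω → ℝ} {a b : ℝ} (hab : a ≤ b) (hY : ∀ ω, Y ω = a ∨ Y ω = b) :
    ENNReal.ofReal (thresholdCost f ((a + b) / 2)) ≤ ∫⁻ ω, ENNReal.ofReal ((U ω - Y ω) ^ 2) ∂μ := by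
  have hF := integral_Iic_pos hpos hint ((a + b) / 2)
  have hG := integral_Ioi_pos hpos hint ((a + b) / 2)
  have hmeas : Measurable fun u : ℝ => if u ≤ (a + b) / 2 then (u - a) ^ 2 else (u - b) ^ 2 :=
    Measurable.ite measurableSet_Iic (by fun_prop) (by fun_prop)
  calc _ ≤ _ := ENNReal.ofReal_le_ofReal (by
        have h1 := mul_nonneg hF.le (sq_nonneg (a - lowerMean f ((a + b) / 2)))
        have h2 := mul_nonneg hG.le (sq_nonneg (b - upperMean f ((a + b) / 2)))
        linarith)
    _ = _ := (lintegral_threshold hpos hint hint1 hint2 ((a + b) / 2) a b).symm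
    _ = _ := (lintegral_comp_eq_of_map_eq hf hU hlaw hmeas).symm
    _ ≤ _ := lintegral_mono fun ω => ENNReal.ofReal_le_ofReal (by
        split_ifs with h <;> rcases hY ω with h' | h' <;> rw [h'] <;> nlinarith)

theorem lintegral_sub_condExp_sgn {Ω : Type*} [MeasurableSpace Ω] {μ : Measure Ω}
    [IsProbabilityMeasure μ] {f : ℝ → ℝ} {U : Ω → ℝ} (hf : Measurable f) (hpos : ∀ x, 0 < f x)
    (hint : Integrable f) (hint1 : Integrable (fun u => u * f u))
    (hint2 : Integrable (fun u => u ^ 2 * f u)) (hU : Measurable U)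
    (hlaw : Measure.map U μ = volume.withDensity (fun u => ENNReal.ofReal (f u))) (τ : ℝ) :
    ∫⁻ ω, ENNReal.ofReal
        ((U ω - (μ[U|MeasurableSpace.comap (fun ω => sgn (U ω - τ)) inferInstance]) ω) ^ 2) ∂μ
      = ENNReal.ofReal (thresholdCost f τ) := by
  have hS : Measurable fun ω => sgn (U ω - τ) := measurable_sgn.comp (hU.sub_const τ)
  obtain ⟨h, -, hh⟩ := (stronglyMeasurable_condExp (μ := μ) (f := U)
    (m := MeasurableSpace.comap (fun ω => sgn (U ω - τ)) inferInstance)).exists_eq_measurable_comp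
  have hUint := integrable_of_map_eq hf hpos hU hlaw hint1
  have key : ∀ (s : Set ℝ) (c : ℝ), MeasurableSet s →
      (∀ u, sgn (u - τ) = c ↔ u ∈ s) → h c * ∫ u in s, f u = ∫ u in s, u * f u := by
    intro s c hs hc
    have hpre : U ⁻¹' s = (fun ω => sgn (U ω - τ)) ⁻¹' {c} := by
      ext ω
      simp [hc]
    have h1 := setIntegral_condExp (μ := μ) (f := U) hS.comap_le hUint
      (s := U ⁻¹' s) ⟨{c}, measurableSet_singleton c, hpre.symm⟩
    have h2 : ∫ ω in U ⁻¹' s,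
        (μ[U|MeasurableSpace.comap (fun ω => sgn (U ω - τ)) inferInstance]) ω ∂μ
        = ∫ ω in U ⁻¹' s, (fun _ => h c) (U ω) ∂μ := by
      refine setIntegral_congr_fun (hU hs) fun ω hω => ?_
      have : sgn (U ω - τ) = c := (hc _).2 hω
      simp [hh, this]
    rw [h2, setIntegral_comp_eq_of_map_eq hf hpos hU hlaw measurable_const hs,
      integral_const_mul] at h1
    rw [h1]
    exact setIntegral_comp_eq_of_map_eq hf hpos hU hlaw measurable_id hs
  have hone : h 1 = upperMean f τ := by
    rw [upperMean, eq_div_iff (integral_Ioi_pos hpos hint τ).ne']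
    refine key _ 1 measurableSet_Ioi fun u => ?_
    unfold sgn
    split_ifs with hu <;> simp <;> norm_num <;> linarith
  have hneg : h (-1) = lowerMean f τ := by
    rw [lowerMean, eq_div_iff (integral_Iic_pos hpos hint τ).ne']
    refine key _ (-1) measurableSet_Iic fun u => ?_
    unfold sgn
    split_ifs with hu <;> simp <;> norm_num <;> linarith
  have hmeas : Measurable fun u : ℝ =>
      if u ≤ τ then (u - lowerMean f τ) ^ 2 else (u - upperMean f τ) ^ 2 :=
    Measurable.ite measurableSet_Iic (by fun_prop) (by fun_prop)
  have hval := lintegral_threshold hpos hint hint1 hint2 τ (lowerMean f τ) (upperMean f τ)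
  rw [← lintegral_comp_eq_of_map_eq hf hU hlaw hmeas] at hval
  simp only [sub_self, ne_eq, OfNat.ofNat_ne_zero, not_false_eq_true, zero_pow, mul_zero,
    add_zero] at hval
  rw [← hval]
  refine lintegral_congr fun ω => ?_
  rw [hh, Function.comp_apply, sgn]
  by_cases hω : U ω ≤ τ
  · rw [if_pos hω, if_neg (by linarith), hneg]
  · rw [if_neg hω, if_pos (by linarith), hone]

/-- The threshold message minimizes the one-bit quantization MSE: let `U` have a strictly
positive, continuous, log-concave density `f` with finite second moment, let `τ` be the
solution of `2τ = (∫_τ^∞ u f)/(∫_τ^∞ f) + (∫_{−∞}^τ u f)/(∫_{−∞}^τ f)`, and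
`M*(u) = sgn(u − τ)`. Then for every measurable one-bit message `M : ℝ → {−1,1}`,
`E[(U − E[U | M(U)])²] ≥ E[(U − E[U | M*(U)])²]`. -/
theorem threshold_message_minimizes_mse
    {Ω : Type*} [MeasurableSpace Ω] (μ : Measure Ω) [IsProbabilityMeasure μ]
    (f : ℝ → ℝ)
    (hf_pos : ∀ x, 0 < f x)
    (hf_cont : Continuous f)
    (hf_logconc : ConcaveOn ℝ Set.univ (fun x => Real.log (f x)))
    (hf_int : Integrable f)
    (hf_prob : ∫ x, f x = 1)
    (hf_mom2 : Integrable (fun u => u ^ 2 * f u))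
    (U : Ω → ℝ) (hU_meas : Measurable U)
    (hU_law : Measure.map U μ = volume.withDensity (fun u => ENNReal.ofReal (f u)))
    (τ : ℝ)
    (hτ : 2 * τ = (∫ u in Set.Ioi τ, u * f u) / (∫ u in Set.Ioi τ, f u) +
        (∫ u in Set.Iic τ, u * f u) / (∫ u in Set.Iic τ, f u)) :
    ∀ M : ℝ → ℝ, Measurable M → (∀ x, M x = 1 ∨ M x = -1) →
      ∫⁻ ω, ENNReal.ofReal
          ((U ω - (μ[U|MeasurableSpace.comap (fun ω => M (U ω)) inferInstance]) ω) ^ 2) ∂μ ≥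
        ∫⁻ ω, ENNReal.ofReal
          ((U ω - (μ[U|MeasurableSpace.comap (fun ω => sgn (U ω - τ)) inferInstance]) ω) ^ 2) ∂μ := by
  intro M _ hM
  have hf := hf_cont.measurable
  have hint1 : Integrable (fun u => u * f u) := by
    refine (hf_int.add hf_mom2).mono' (measurable_id.mul hf).aestronglyMeasurable
      (ae_of_all _ fun u => ?_)
    have hu : |u| ≤ 1 + u ^ 2 := abs_le.2 ⟨by nlinarith, by nlinarith⟩
    rw [Real.norm_eq_abs, abs_mul, abs_of_pos (hf_pos u)]
    calc |u| * f u ≤ (1 + u ^ 2) * f u := mul_le_mul_of_nonneg_right hu (hf_pos u).le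
      _ = _ := by simp only [Pi.add_apply]; ring
  rw [ge_iff_le, lintegral_sub_condExp_sgn hf hf_pos hf_int hint1 hf_mom2 hU_meas hU_law τ]
  obtain ⟨h, -, hh⟩ := (stronglyMeasurable_condExp (μ := μ) (f := U)
    (m := MeasurableSpace.comap (fun ω => M (U ω)) inferInstance)).exists_eq_measurable_comp
  have hval : ∀ ω, (μ[U|MeasurableSpace.comap (fun ω => M (U ω)) inferInstance]) ω = h 1 ∨
      (μ[U|MeasurableSpace.comap (fun ω => M (U ω)) inferInstance]) ω = h (-1) := by
    intro ω
    rw [hh]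
    rcases hM (U ω) with h' | h' <;> simp [h']
  refine (ENNReal.ofReal_le_ofReal
    (thresholdCost_le hf_pos hf_cont hf_logconc hf_int hint1 hτ ((h 1 + h (-1)) / 2))).trans ?_
  rcases le_total (h 1) (h (-1)) with hle | hle
  · exact ofReal_thresholdCost_le_lintegral hf hf_pos hf_int hint1 hf_mom2 hU_meas hU_law hle hval
  · rw [add_comm]
    exact ofReal_thresholdCost_le_lintegral hf hf_pos hf_int hint1 hf_mom2 hU_meas hU_law hle
      fun ω => (hval ω).symm
end
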